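/- (Small grains retained.) Fix λ > 0 and a Borel probability measure F on [0,∞) with ∫ r^d F(dr) < ∞. Define h(r) = exp(−λ ∫_{[0,r]} |B_{r+s}(0)| F(ds)); h₂(u, r₁, r₂) = 0 if u ≤ r₁+r₂ and h₂(u, r₁, r₂) = h(r₁)·h(r₂)·exp(λ ∫_{[0,min(r₁,r₂)]} |B_{r₁+s}(0) ∩ B_{r₂+s}(u·e₁)| F(ds)) if u > r₁+r₂; q(u,r₁,r₂) = h₂(u,r₁,r₂) − h(r₁)h(r₂); λ_th = λ ∫ h(r) F(dr); F̄_th(r) = (λ/λ_th) ∫_{(r,∞)} h(s) F(ds); k_th(z) = λ ∫ |B_r(0) ∩ B_r(z)| h(r) F(dr) + λ² ∭ |B_{r₁}(0) ∩ B_{r₂}(x)|·q(|x−z|, r₁, r₂) dx F(dr₁) F(dr₂); and ξ_th(z) = (λ/λ_th)² ∬ q(|z|, r₁, r₂) F(dr₁) F(dr₂). Then there exists c ∈ (0,∞) such that for all sufficiently large r and all z ∈ ℝ^d with |z| sufficiently large: F̄_th(r) ≤ (λ/λ_th)·exp(−(1/2)·λ·|B_1(0)|·r^d), |k_th(z)|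 ≤ exp(−λ·|B_1(0)|·c·|z|^d), and |ξ_th(z)| ≤ exp(−λ·|B_1(0)|·c·|z|^d). -/

import Mathlib

open MeasureTheory Filter Set Metric ProbabilityTheory

noncomputable section

/-- A measurable positive function is slowly varying at infinity if `ℓ(a t)/ℓ(t) → 1`
as `t → ∞` for every `a > 0`. -/
def SlowlyVarying (ℓ : ℝ → ℝ) : Prop :=
  Measurable ℓ ∧ (∀ x > 0, 0 < ℓ x) ∧
    ∀ a > 0, Tendsto (fun t => ℓ (a * t) / ℓ t) atTop (nhds 1)

/-- Tail function `F̄(x) = F((x,∞))` of a measure on `ℝ`. -/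
def tailF (F : Measure ℝ) (x : ℝ) : ℝ := (F (Ioi x)).toReal

/-- `d`-dimensional Euclidean space. -/
abbrev Euc (d : ℕ) := EuclideanSpace ℝ (Fin d)

/-- The first standard basis vector of `ℝ^d`. -/
def e1 (d : ℕ) : Euc d := if h : 0 < d then EuclideanSpace.single (⟨0, h⟩ : Fin d) 1 else 0

/-- Volume of the closed ball of radius `r` in `ℝ^d`. -/
def ballVol (d : ℕ) (r : ℝ) : ℝ := (volume (closedBall (0 : Euc d) r)).toReal

/-- Volume of the intersection of closed balls `B_r(x)` and `B_s(y)` in `ℝ^d`. -/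
def interVol (d : ℕ) (x : Euc d) (r : ℝ) (y : Euc d) (s : ℝ) : ℝ :=
  (volume (closedBall x r ∩ closedBall y s)).toReal

/-- The constant `c_{α,d} = ∫₀^∞ |B_r(0) ∩ B_r(e₁)| α r^{-α-1} dr`. -/
def cconst (d : ℕ) (α : ℝ) : ℝ :=
  ∫ r in Ioi (0 : ℝ), interVol d 0 r (e1 d) r * (α * r ^ (-α - 1))

/-- Retention probability for the small-retained thinning. -/
def hS (d : ℕ) (lam : ℝ) (F : Measure ℝ) (r : ℝ) : ℝ :=
  Real.exp (-(lam * ∫ s in Icc 0 r, ballVol d (r + s) ∂F))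

/-- Pair retention probability for the small-retained thinning. -/
def h2S (d : ℕ) (lam : ℝ) (F : Measure ℝ) (u r₁ r₂ : ℝ) : ℝ :=
  if u ≤ r₁ + r₂ then 0
  else hS d lam F r₁ * hS d lam F r₂ *
    Real.exp (lam * ∫ s in Icc 0 (min r₁ r₂),
      interVol d 0 (r₁ + s) (u • e1 d) (r₂ + s) ∂F)

/-- Retention covariance for the small-retained thinning. -/
def qS (d : ℕ) (lam : ℝ) (F : Measure ℝ) (u r₁ r₂ : ℝ) : ℝ :=
  h2S d lam F u r₁ r₂ - hS d lam F r₁ * hS d lam F r₂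

/-- Thinned germ density `λ_th = λ ∫ h(r) F(dr)`. -/
def lamth (lam : ℝ) (F : Measure ℝ) (h : ℝ → ℝ) : ℝ := lam * ∫ r, h r ∂F

/-- Tail distribution `F̄_th(r) = (λ/λ_th) ∫_{(r,∞)} h(s) F(ds)` of the radius of a
typical grain in the thinned model. -/
def tailth (lam : ℝ) (F : Measure ℝ) (h : ℝ → ℝ) (r : ℝ) : ℝ :=
  (lam / lamth lam F h) * ∫ s in Ioi r, h s ∂F

/-- Volume fraction `p_th = λ ∫ |B_r(0)| h(r) F(dr)` of the thinned grain cover. -/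
def pth (d : ℕ) (lam : ℝ) (F : Measure ℝ) (h : ℝ → ℝ) : ℝ :=
  lam * ∫ r, ballVol d r * h r ∂F

/-- Covariance function of the thinned grain cover. -/
def kth (d : ℕ) (lam : ℝ) (F : Measure ℝ) (h : ℝ → ℝ) (q : ℝ → ℝ → ℝ → ℝ)
    (z : Euc d) : ℝ :=
  lam * ∫ r, interVol d 0 r z r * h r ∂F +
    lam ^ 2 * ∫ r₁, (∫ r₂, (∫ x, interVol d 0 r₁ x r₂ * q (‖x - z‖) r₁ r₂) ∂F) ∂F

/-- Two-point correlation function of the thinned grain centers. -/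
def xith (d : ℕ) (lam : ℝ) (F : Measure ℝ) (h : ℝ → ℝ) (q : ℝ → ℝ → ℝ → ℝ)
    (z : Euc d) : ℝ :=
  (lam / lamth lam F h) ^ 2 * ∫ r₁, (∫ r₂, q ‖z‖ r₁ r₂ ∂F) ∂F


theorem ballVol_eq (d : ℕ) {r : ℝ} (hr : 0 ≤ r) : ballVol d r = ballVol d 1 * r ^ d := by
  unfold ballVol
  rw [Measure.addHaar_closedBall _ _ hr, Measure.addHaar_closedBall _ _ zero_le_one]
  simp [ENNReal.toReal_mul, ENNReal.toReal_ofReal (pow_nonneg hr d), mul_comm]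

theorem ballVol_one_pos (d : ℕ) : 0 < ballVol d 1 := by
  unfold ballVol
  exact ENNReal.toReal_pos (measure_closedBall_pos _ _ one_pos).ne' measure_closedBall_lt_top.ne

theorem ballVol_nonneg (d : ℕ) (r : ℝ) : 0 ≤ ballVol d r := ENNReal.toReal_nonneg

theorem interVol_nonneg (d : ℕ) (x : Euc d) (r : ℝ) (y : Euc d) (s : ℝ) :
    0 ≤ interVol d x r y s := ENNReal.toReal_nonneg

theorem interVol_le_left (d : ℕ) (r : ℝ) (y : Euc d) (s : ℝ) :
    interVol d 0 r y s ≤ ballVol d r :=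
  ENNReal.toReal_mono measure_closedBall_lt_top.ne (measure_mono inter_subset_left)

theorem interVol_le_right (d : ℕ) (r : ℝ) (y : Euc d) (s : ℝ) :
    interVol d 0 r y s ≤ ballVol d s := by
  unfold ballVol interVol
  rw [← Measure.addHaar_closedBall_center volume y s]
  exact ENNReal.toReal_mono measure_closedBall_lt_top.ne (measure_mono inter_subset_right)

theorem interVol_eq_zero (d : ℕ) (r : ℝ) (y : Euc d) (s : ℝ) (h : r + s < ‖y‖) :
    interVol d 0 r y s = 0 := by
  have : closedBall (0 : Euc d) r ∩ closedBall y s = ∅ := by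
    rw [← Set.disjoint_iff_inter_eq_empty]
    apply closedBall_disjoint_closedBall
    simpa [dist_eq_norm] using h
  simp [interVol, this]

theorem interVol_le_max (d : ℕ) (r : ℝ) (y : Euc d) (s : ℝ) :
    interVol d 0 r y s ≤ ballVol d (max r s) := by
  rcases max_choice r s with h | h <;> rw [h]
  · exact interVol_le_left d r y s
  · exact interVol_le_right d r y s

theorem norm_e1 (d : ℕ) (hd : 0 < d) : ‖e1 d‖ = 1 := by
  simp [e1, hd]

theorem hS_pos (d : ℕ) (lam : ℝ) (F : Measure ℝ) (r : ℝ) : 0 < hS d lam F r := Real.exp_pos _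

theorem hS_le_one (d : ℕ) (lam : ℝ) (hlam : 0 < lam) (F : Measure ℝ) (r : ℝ) :
    hS d lam F r ≤ 1 := by
  unfold hS
  rw [Real.exp_le_one_iff]
  have : 0 ≤ ∫ s in Icc 0 r, ballVol d (r + s) ∂F :=
    integral_nonneg fun s => ballVol_nonneg d _
  nlinarith [mul_nonneg hlam.le this]

theorem integrable_ballVol (d : ℕ) (F : Measure ℝ) [IsProbabilityMeasure F] {r : ℝ}
    (hr : 0 ≤ r) : IntegrableOn (fun s => ballVol d (r + s)) (Icc 0 r) F := by
  have h1 : IntegrableOn (fun s => ballVol d 1 * (r + s) ^ d) (Icc 0 r) F := by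
    apply ContinuousOn.integrableOn_compact isCompact_Icc
    fun_prop
  refine h1.congr_fun (fun s hs => ?_) measurableSet_Icc
  exact (ballVol_eq d (add_nonneg hr hs.1)).symm

theorem hS_le (d : ℕ) (lam : ℝ) (hlam : 0 < lam) (F : Measure ℝ) [IsProbabilityMeasure F]
    {r : ℝ} (hr : 0 ≤ r) (hF : 3 / 4 ≤ F.real (Icc 0 r)) :
    hS d lam F r ≤ Real.exp (-(3 / 4 * (lam * (ballVol d 1 * r ^ d)))) := by
  unfold hS
  apply Real.exp_le_exp.2
  apply neg_le_neg
  have h1 : ∫ s in Icc 0 r, ballVol d 1 * r ^ d ∂F ≤ ∫ s in Icc 0 r, ballVol d (r + s) ∂F := by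
    refine setIntegral_mono_on (integrable_const _) (integrable_ballVol d F hr) measurableSet_Icc ?_
    intro s hs
    rw [ballVol_eq d (add_nonneg hr hs.1)]
    have := ballVol_nonneg d 1
    have := hs.1
    gcongr
    linarith
  rw [setIntegral_const, smul_eq_mul] at h1
  have h2 : 0 ≤ ballVol d 1 * r ^ d := mul_nonneg (ballVol_nonneg d 1) (pow_nonneg hr d)
  nlinarith [mul_le_mul_of_nonneg_right hF h2]

theorem hS_mul_min (d : ℕ) (lam : ℝ) (F : Measure ℝ) (r₁ r₂ : ℝ) :
    hS d lam F r₁ * hS d lam F r₂ = hS d lam F (min r₁ r₂) * hS d lam F (max r₁ r₂) := by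
  rcases le_total r₁ r₂ with h | h
  · simp [h]
  · simp [h, mul_comm]

theorem abs_qS_le (d : ℕ) (lam : ℝ) (hlam : 0 < lam) (F : Measure ℝ)
    [IsProbabilityMeasure F] (u : ℝ) {r₁ r₂ : ℝ} (h1 : 0 ≤ r₁) (h2 : 0 ≤ r₂) :
    |qS d lam F u r₁ r₂| ≤ hS d lam F (max r₁ r₂) := by
  have ha := hS_pos d lam F (min r₁ r₂)
  have hb := hS_pos d lam F (max r₁ r₂)
  have ha1 := hS_le_one d lam hlam F (min r₁ r₂)
  have hprod : 0 ≤ hS d lam F r₁ * hS d lam F r₂ ∧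
      hS d lam F r₁ * hS d lam F r₂ ≤ hS d lam F (max r₁ r₂) := by
    rw [hS_mul_min]
    constructor
    · positivity
    · nlinarith
  have hh2 : 0 ≤ h2S d lam F u r₁ r₂ ∧ h2S d lam F u r₁ r₂ ≤ hS d lam F (max r₁ r₂) := by
    unfold h2S
    split_ifs with hu
    · exact ⟨le_rfl, hb.le⟩
    · refine ⟨mul_nonneg hprod.1 (Real.exp_pos _).le, ?_⟩
      rw [hS_mul_min, mul_right_comm]
      apply mul_le_of_le_one_left hb.le
      unfold hS
      rw [← Real.exp_add, Real.exp_le_one_iff]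
      have : ∫ s in Icc 0 (min r₁ r₂), interVol d 0 (r₁ + s) (u • e1 d) (r₂ + s) ∂F ≤
          ∫ s in Icc 0 (min r₁ r₂), ballVol d (min r₁ r₂ + s) ∂F := by
        apply integral_mono_of_nonneg
        · exact ae_of_all _ fun s => interVol_nonneg ..
        · exact integrable_ballVol d F (le_min h1 h2)
        · refine ae_of_all _ fun s => ?_
          rcases min_choice r₁ r₂ with h | h <;> simp only [h]
          · exact interVol_le_left ..
          · exact interVol_le_right ..
      nlinarith [mul_le_mul_of_nonneg_left this hlam.le]
  unfold qS
  rw [abs_le]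
  constructor <;> linarith [hprod.1, hprod.2, hh2.1, hh2.2]

theorem qS_eq_zero (d : ℕ) (hd : 0 < d) (lam : ℝ) (F : Measure ℝ)
    (u : ℝ) {r₁ r₂ : ℝ} (h1 : 0 ≤ r₁) (h2 : 0 ≤ r₂) (hu : 4 * max r₁ r₂ < u) :
    qS d lam F u r₁ r₂ = 0 := by
  have m1 := le_max_left r₁ r₂
  have m2 := le_max_right r₁ r₂
  have hi : ∫ s in Icc 0 (min r₁ r₂), interVol d 0 (r₁ + s) (u • e1 d) (r₂ + s) ∂F = 0 := by
    rw [setIntegral_congr_fun measurableSet_Icc (g := fun _ => (0 : ℝ))]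
    · simp
    · intro s hs
      apply interVol_eq_zero
      rw [norm_smul, norm_e1 d hd, Real.norm_eq_abs, mul_one]
      have := hs.2.trans (min_le_left _ _)
      have := le_abs_self u
      linarith
  unfold qS h2S
  rw [if_neg (by linarith), hi]
  simp

/-- The x-integral. -/
theorem inner_bound (d : ℕ) (hd : 0 < d) (lam : ℝ) (hlam : 0 < lam) (F : Measure ℝ)
    [IsProbabilityMeasure F] (z : Euc d) {r₁ r₂ : ℝ} (h1 : 0 ≤ r₁) (h2 : 0 ≤ r₂) :
    |∫ x, interVol d 0 r₁ x r₂ * qS d lam F (‖x - z‖) r₁ r₂| ≤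
      ballVol d (max r₁ r₂) * hS d lam F (max r₁ r₂) * ballVol d (2 * max r₁ r₂) ∧
    (6 * max r₁ r₂ < ‖z‖ →
      ∫ x, interVol d 0 r₁ x r₂ * qS d lam F (‖x - z‖) r₁ r₂ = 0) := by
  have m1 := le_max_left r₁ r₂
  have m2 := le_max_right r₁ r₂
  constructor
  · rw [← setIntegral_eq_integral_of_forall_compl_eq_zero
      (s := closedBall (0 : Euc d) (2 * max r₁ r₂))]
    · rw [← Real.norm_eq_abs]
      refine norm_setIntegral_le_of_norm_le_const
        (measure_closedBall_lt_top (μ := (volume : Measure (Euc d)))) fun x _ => ?_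
      rw [norm_mul, Real.norm_eq_abs, Real.norm_eq_abs, abs_of_nonneg (interVol_nonneg ..)]
      exact mul_le_mul (interVol_le_max ..) (abs_qS_le d lam hlam F _ h1 h2) (abs_nonneg _)
        (ballVol_nonneg ..)
    · intro x hx
      rw [mem_closedBall_zero_iff, not_le] at hx
      rw [interVol_eq_zero _ _ _ _ (by linarith), zero_mul]
  · intro hz
    rw [integral_eq_zero_of_ae]
    refine ae_of_all _ fun x => ?_
    by_cases hx : r₁ + r₂ < ‖x‖
    · simp [interVol_eq_zero _ _ _ _ hx]
    · have : ‖z‖ ≤ ‖x‖ + ‖x - z‖ := by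
        have := norm_sub_le x (x - z)
        simpa using this
      rw [not_lt] at hx
      simp [qS_eq_zero d hd lam F ‖x - z‖ h1 h2 (by linarith)]

theorem exists_R (F : Measure ℝ) [IsProbabilityMeasure F] (hsupp : F (Iio 0) = 0) :
    ∃ R : ℝ, 0 ≤ R ∧ ∀ r, R ≤ r → 3 / 4 ≤ F.real (Icc 0 r) := by
  have h1 : Tendsto (fun r : ℝ => F (Iic r)) atTop (nhds (F univ)) := tendsto_measure_Iic_atTop F
  rw [measure_univ] at h1
  have h2 : Tendsto (fun r : ℝ => F.real (Iic r)) atTop (nhds 1) :=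
    (ENNReal.tendsto_toReal ENNReal.one_ne_top).comp h1
  have h3 := (h2.eventually (lt_mem_nhds (show (3 / 4 : ℝ) < 1 by norm_num)))
  obtain ⟨R, hR⟩ := eventually_atTop.1 h3
  refine ⟨max R 0, le_max_right _ _, fun r hr => ?_⟩
  have h4 := hR r ((le_max_left _ _).trans hr)
  have h5 : F.real (Iic r) ≤ F.real (Iio 0 ∪ Icc 0 r) := by
    refine measureReal_mono (fun x hx => ?_) (measure_ne_top _ _)
    rcases lt_or_ge x 0 with h | h
    · exact Or.inl h
    · exact Or.inr ⟨h, hx⟩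
  have h6 := measureReal_union_le (μ := F) (Iio 0) (Icc 0 r)
  have h7 : F.real (Iio 0) = 0 := by simp [measureReal_def, hsupp]
  linarith

theorem aux_one (T H : ℝ) (hT : 0 ≤ T) (hH : H ≤ Real.exp (-(3 / 4 * T))) :
    H ≤ Real.exp (-(1 / 2 * T)) ∧ T * H ≤ 4 * Real.exp (-(1 / 2 * T)) ∧
      T ^ 2 * H ≤ 32 * Real.exp (-(1 / 2 * T)) := by
  have e : Real.exp (-(1 / 2 * T)) = Real.exp (T / 4) * Real.exp (-(3 / 4 * T)) := by
    rw [← Real.exp_add]; ring_nf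
  have p := Real.exp_pos (-(3 / 4 * T))
  have a1 : T ≤ 4 * Real.exp (T / 4) := by linarith [Real.add_one_le_exp (T / 4)]
  have a0 : 1 ≤ Real.exp (T / 4) := Real.one_le_exp (by linarith)
  have a2 : T ^ 2 ≤ 32 * Real.exp (T / 4) := by
    have := Real.quadratic_le_exp_of_nonneg (show 0 ≤ T / 4 by linarith)
    nlinarith
  rw [e]
  refine ⟨?_, ?_, ?_⟩
  · nlinarith
  · calc T * H ≤ T * Real.exp (-(3 / 4 * T)) := by gcongr
      _ ≤ 4 * Real.exp (T / 4) * Real.exp (-(3 / 4 * T)) := by gcongr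
      _ = _ := by ring
  · calc T ^ 2 * H ≤ T ^ 2 * Real.exp (-(3 / 4 * T)) := by gcongr
      _ ≤ 32 * Real.exp (T / 4) * Real.exp (-(3 / 4 * T)) := by gcongr
      _ = _ := by ring

/-- Bounds on `h` for radii at least a sixth of `w`. -/
theorem hS_bounds (d : ℕ) (lam : ℝ) (hlam : 0 < lam) (F : Measure ℝ)
    [IsProbabilityMeasure F] {R : ℝ} (hR0 : 0 ≤ R)
    (hR : ∀ r, R ≤ r → 3 / 4 ≤ F.real (Icc 0 r)) {w b : ℝ} (hw : R ≤ w) (hb : w ≤ b) :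
    hS d lam F b ≤ Real.exp (-(1 / 2 * (lam * (ballVol d 1 * w ^ d)))) ∧
    lam * (ballVol d b * hS d lam F b) ≤
      4 * Real.exp (-(1 / 2 * (lam * (ballVol d 1 * w ^ d)))) ∧
    lam ^ 2 * (ballVol d b * hS d lam F b * ballVol d (2 * b)) ≤
      32 * 2 ^ d * Real.exp (-(1 / 2 * (lam * (ballVol d 1 * w ^ d)))) := by
  have hw0 : 0 ≤ w := hR0.trans hw
  have hb0 : 0 ≤ b := hw0.trans hb
  have hV := ballVol_nonneg d 1
  obtain ⟨x1, x2, x3⟩ := aux_one (lam * (ballVol d 1 * b ^ d)) (hS d lam F b) (by positivity)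
    (hS_le d lam hlam F hb0 (hR b (hw.trans hb)))
  have m : Real.exp (-(1 / 2 * (lam * (ballVol d 1 * b ^ d)))) ≤
      Real.exp (-(1 / 2 * (lam * (ballVol d 1 * w ^ d)))) := by
    gcongr
  rw [ballVol_eq d hb0, ballVol_eq d (show 0 ≤ 2 * b by linarith), mul_pow]
  refine ⟨x1.trans m, ?_, ?_⟩
  · nlinarith
  · have : (0 : ℝ) < 2 ^ d := by positivity
    calc _ = 2 ^ d * ((lam * (ballVol d 1 * b ^ d)) ^ 2 * hS d lam F b) := by ring
      _ ≤ 2 ^ d * (32 * Real.exp (-(1 / 2 * (lam * (ballVol d 1 * w ^ d))))) := by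
        exact mul_le_mul_of_nonneg_left (by linarith) this.le
      _ = _ := by ring

theorem prob_bound (F : Measure ℝ) [IsProbabilityMeasure F] (hsupp : F (Iio 0) = 0)
    (f : ℝ → ℝ) (C : ℝ) (h : ∀ r, 0 ≤ r → |f r| ≤ C) : |∫ r, f r ∂F| ≤ C := by
  have := norm_integral_le_of_norm_le_const (μ := F) (f := f) (C := C) (by
    have : ∀ᵐ r ∂F, r ∉ Iio (0 : ℝ) := measure_eq_zero_iff_ae_notMem.1 hsupp
    filter_upwards [this] with r hr
    exact h r (not_lt.1 hr))
  simpa using this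

theorem k_xi_bound (d : ℕ) (hd : 0 < d) (lam : ℝ) (hlam : 0 < lam) (F : Measure ℝ)
    [IsProbabilityMeasure F] (hsupp : F (Iio 0) = 0) {R : ℝ} (hR0 : 0 ≤ R)
    (hR : ∀ r, R ≤ r → 3 / 4 ≤ F.real (Icc 0 r)) (z : Euc d) (hz : R ≤ ‖z‖ / 6) :
    |kth d lam F (hS d lam F) (qS d lam F) z| ≤
      (4 + 32 * 2 ^ d) * Real.exp (-(1 / 2 * (lam * (ballVol d 1 * (‖z‖ / 6) ^ d)))) ∧
    |xith d lam F (hS d lam F) (qS d lam F) z| ≤ (lam / lamth lam F (hS d lam F)) ^ 2 *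
      Real.exp (-(1 / 2 * (lam * (ballVol d 1 * (‖z‖ / 6) ^ d)))) := by
  have key := fun b => hS_bounds d lam hlam F hR0 hR (b := b) hz
  set E := Real.exp (-(1 / 2 * (lam * (ballVol d 1 * (‖z‖ / 6) ^ d)))) with hE
  have hE0 : 0 < E := Real.exp_pos _
  have hz0 := norm_nonneg z
  constructor
  · unfold kth
    refine (abs_add_le _ _).trans ?_
    rw [add_mul]
    apply add_le_add
    · rw [← integral_const_mul]
      apply prob_bound F hsupp
      intro r hr
      have hn : 0 ≤ lam * (interVol d 0 r z r * hS d lam F r) :=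
        mul_nonneg hlam.le (mul_nonneg (interVol_nonneg ..) (hS_pos ..).le)
      rw [abs_of_nonneg hn]
      by_cases h : r + r < ‖z‖
      · rw [interVol_eq_zero _ _ _ _ h]
        simp only [zero_mul, mul_zero]; positivity
      · refine le_trans ?_ (key r (by linarith)).2.1
        have := interVol_le_left d r z r
        have := hS_pos d lam F r
        gcongr
    · rw [← integral_const_mul]
      apply prob_bound F hsupp
      intro r₁ h1
      rw [← integral_const_mul]
      apply prob_bound F hsupp
      intro r₂ h2
      obtain ⟨b1, b2⟩ := inner_bound d hd lam hlam F z h1 h2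
      rw [abs_mul, abs_of_nonneg (by positivity)]
      by_cases h : 6 * max r₁ r₂ < ‖z‖
      · rw [b2 h]
        simp only [abs_zero, mul_zero]; positivity
      · refine le_trans ?_ (key (max r₁ r₂) (by linarith)).2.2
        gcongr
  · unfold xith
    rw [abs_mul, abs_of_nonneg (sq_nonneg _)]
    gcongr
    apply prob_bound F hsupp
    intro r₁ h1
    apply prob_bound F hsupp
    intro r₂ h2
    by_cases h : 4 * max r₁ r₂ < ‖z‖
    · rw [qS_eq_zero d hd lam F _ h1 h2 h, abs_zero]
      exact hE0.le
    · exact (abs_qS_le d lam hlam F _ h1 h2).trans (key _ (by linarith)).1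

theorem tail_bound (d : ℕ) (lam : ℝ) (hlam : 0 < lam) (F : Measure ℝ)
    [IsProbabilityMeasure F] {R : ℝ} (hR0 : 0 ≤ R)
    (hR : ∀ r, R ≤ r → 3 / 4 ≤ F.real (Icc 0 r)) (r : ℝ) (hr : R ≤ r) :
    tailth lam F (hS d lam F) r ≤ (lam / lamth lam F (hS d lam F)) *
          Real.exp (-(1 / 2 * lam * ballVol d 1 * r ^ d)) := by
  unfold tailth
  have h0 : 0 ≤ lam / lamth lam F (hS d lam F) := by
    unfold lamth
    have : 0 ≤ ∫ r, hS d lam F r ∂F := integral_nonneg fun s => (hS_pos ..).le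
    positivity
  apply mul_le_mul_of_nonneg_left _ h0
  refine (le_abs_self _).trans ?_
  have := norm_setIntegral_le_of_norm_le_const (μ := F) (s := Ioi r) (f := hS d lam F)
    (C := Real.exp (-(1 / 2 * (lam * (ballVol d 1 * r ^ d))))) (measure_lt_top _ _) (by
      intro s hs
      rw [Real.norm_eq_abs, abs_of_pos (hS_pos ..)]
      exact (hS_bounds d lam hlam F hR0 hR hr (le_of_lt hs)).1)
  rw [Real.norm_eq_abs] at this
  refine this.trans ?_
  have e : -(1 / 2 * (lam * (ballVol d 1 * r ^ d))) = -(1 / 2 * lam * ballVol d 1 * r ^ d) := by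
    ring
  rw [e]
  exact mul_le_of_le_one_right (Real.exp_pos _).le measureReal_le_one

theorem absorb (d : ℕ) (hd : 0 < d) (lam : ℝ) (hlam : 0 < lam) (K : ℝ) :
    ∀ᶠ t : ℝ in atTop, K * Real.exp (-(1 / 2 * (lam * (ballVol d 1 * (t / 6) ^ d)))) ≤
      Real.exp (-(lam * ballVol d 1 * (1 / (4 * 6 ^ d)) * t ^ d)) := by
  have hV := ballVol_one_pos d
  have h1 : Tendsto (fun t : ℝ => lam * ballVol d 1 * (1 / (4 * 6 ^ d)) * t ^ d) atTop atTop :=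
    (tendsto_pow_atTop hd.ne').const_mul_atTop (by positivity)
  have h2 := Real.tendsto_exp_atTop.comp h1
  filter_upwards [h2.eventually_ge_atTop K] with t ht
  have e : Real.exp (-(lam * ballVol d 1 * (1 / (4 * 6 ^ d)) * t ^ d)) =
      Real.exp (lam * ballVol d 1 * (1 / (4 * 6 ^ d)) * t ^ d) *
      Real.exp (-(1 / 2 * (lam * (ballVol d 1 * (t / 6) ^ d)))) := by
    rw [← Real.exp_add]
    congr 1
    rw [div_pow]
    field_simp
    ring
  rw [e]
  exact mul_le_mul_of_nonneg_right ht (Real.exp_pos _).le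

/-- Small grains retained: exponential decay of the radius tail, the covariance of
the grain cover and the two-point correlation of the grain centers. -/
theorem stmt16 (d : ℕ) (hd : 0 < d) (lam : ℝ) (hlam : 0 < lam)
    (F : Measure ℝ) [IsProbabilityMeasure F] (hsupp : F (Iio 0) = 0)
    (hmom : Integrable (fun r : ℝ => r ^ d) F) :
    ∃ c > 0,
      (∀ᶠ r in atTop, tailth lam F (hS d lam F) r ≤
        (lam / lamth lam F (hS d lam F)) *
          Real.exp (-(1 / 2 * lam * ballVol d 1 * r ^ d))) ∧
      (∀ᶠ z : Euc d in comap norm atTop,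
        |kth d lam F (hS d lam F) (qS d lam F) z| ≤
            Real.exp (-(lam * ballVol d 1 * c * ‖z‖ ^ d)) ∧
          |xith d lam F (hS d lam F) (qS d lam F) z| ≤
            Real.exp (-(lam * ballVol d 1 * c * ‖z‖ ^ d))) := by
  obtain ⟨R, hR0, hR⟩ := exists_R F hsupp
  refine ⟨1 / (4 * 6 ^ d), by positivity, ?_, ?_⟩
  · filter_upwards [eventually_ge_atTop R] with r hr
    exact tail_bound d lam hlam F hR0 hR r hr
  · have hz : Tendsto (fun z : Euc d => ‖z‖) (comap norm atTop) atTop := tendsto_comap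
    filter_upwards [hz.eventually (eventually_ge_atTop (6 * R)),
      hz.eventually (absorb d hd lam hlam (4 + 32 * 2 ^ d)),
      hz.eventually (absorb d hd lam hlam ((lam / lamth lam F (hS d lam F)) ^ 2))]
      with z h1 h2 h3
    obtain ⟨a, b⟩ := k_xi_bound d hd lam hlam F hsupp hR0 hR z (by linarith)
    exact ⟨a.trans h2, b.trans h3⟩
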